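/- arXiv:2502.18251 — 5 statements merged into one kernel-verified Lean document; each statement's English description precedes it below -/
import Mathlib

section
/- For every j ∈ {1,…,m}, the cluster-to-server encoding polynomial satisfies f(β_j) = Σ_{k=1}^{K} g_{k,j}. In other words, evaluating f at the recovery point β_j yields the sum over all dataset indices k of the j-th gradient part g_{k,j}. -/
/- Hierarchical gradient coding: the cluster-to-server encoding polynomial
`f` recovers the sum of the `j`-th gradient parts at the recovery point `β j`. -/
theorem cluster_to_server_recovery
    {F : Type*} [Field F] (N m K : ℕ) (hN : 0 < N) (hm : 0 < m) (hK : 0 < K)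
    (α : Fin N → F) (β : Fin m → F)
    (hdist : Function.Injective (Sum.elim α β : Fin N ⊕ Fin m → F))
    (Γ : Fin N → Finset (Fin K)) (g : Fin K → Fin m → F)
    (p : Fin m → Polynomial F)
    (hp : ∀ l : Fin m, p l = ∑ k : Fin K, Polynomial.C (g k l) *
      ∏ i ∈ Finset.univ.filter (fun i : Fin N => k ∉ Γ i),
        ((Polynomial.X - Polynomial.C (α i)) * Polynomial.C ((β l - α i)⁻¹)))
    (f : Polynomial F)
    (hf : f = ∑ l : Fin m, p l *
      ∏ u ∈ Finset.univ.filter (fun u : Fin m => u ≠ l),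
        ((Polynomial.X - Polynomial.C (β u)) * Polynomial.C ((β l - β u)⁻¹))) :
    ∀ j : Fin m, f.eval (β j) = ∑ k : Fin K, g k j := by
  intro j
  have hab : ∀ i, β j - α i ≠ 0 := by
    intro i h
    have h2 : (Sum.inr j : Fin N ⊕ Fin m) = Sum.inl i := hdist (by simpa using sub_eq_zero.mp h)
    cases h2
  have hbb : ∀ u, u ≠ j → β j - β u ≠ 0 := by
    intro u hu h
    have h2 : (Sum.inr j : Fin N ⊕ Fin m) = Sum.inr u := hdist (by simpa using sub_eq_zero.mp h)
    exact hu (Sum.inr.inj h2).symm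
  have hpj : (p j).eval (β j) = ∑ k : Fin K, g k j := by
    rw [hp j, Polynomial.eval_finsetSum]
    refine Finset.sum_congr rfl fun k _ => ?_
    rw [Polynomial.eval_mul, Polynomial.eval_C, Polynomial.eval_prod, Finset.prod_eq_one, mul_one]
    intro i _
    simp [mul_inv_cancel₀ (hab i)]
  rw [hf, Polynomial.eval_finsetSum, Finset.sum_eq_single j]
  · rw [Polynomial.eval_mul, hpj, Polynomial.eval_prod, Finset.prod_eq_one, mul_one]
    intro u hu
    simp [mul_inv_cancel₀ (hbb u (Finset.mem_filter.mp hu).2)]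
  · intro l _ hl
    rw [Polynomial.eval_mul, Polynomial.eval_prod,
      Finset.prod_eq_zero (i := j) (Finset.mem_filter.mpr ⟨Finset.mem_univ _, hl.symm⟩) (by simp),
      mul_zero]
  · intro h
    exact absurd (Finset.mem_univ j) h
end

section
/- If r ≥ 1 is such that every index k ∈ {1,…,K} belongs to at least r of the sets Γ_1, …, Γ_N, then the cluster-to-server encoding polynomial f has degree at most (N − r) + (m − 1). In particular, with m = r − 2a − s for nonnegative integers a, s, the degree of f is at most N − 2a − s − 1, so f is determined by N − 2a − s evaluations. -/
/- Degree bound for the cluster-to-server encoding polynomial `f`: at most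
`(N - r) + (m - 1)`; in particular, with `m = r - 2a - s`, at most `N - 2a - s - 1`. -/
theorem cluster_to_server_degree_bound
    {F : Type*} [Field F] (N m K : ℕ) (hN : 0 < N) (hm : 0 < m) (hK : 0 < K)
    (α : Fin N → F) (β : Fin m → F)
    (hdist : Function.Injective (Sum.elim α β : Fin N ⊕ Fin m → F))
    (Γ : Fin N → Finset (Fin K)) (g : Fin K → Fin m → F)
    (p : Fin m → Polynomial F)
    (hp : ∀ l : Fin m, p l = ∑ k : Fin K, Polynomial.C (g k l) *
      ∏ i ∈ Finset.univ.filter (fun i : Fin N => k ∉ Γ i),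
        ((Polynomial.X - Polynomial.C (α i)) * Polynomial.C ((β l - α i)⁻¹)))
    (f : Polynomial F)
    (hf : f = ∑ l : Fin m, p l *
      ∏ u ∈ Finset.univ.filter (fun u : Fin m => u ≠ l),
        ((Polynomial.X - Polynomial.C (β u)) * Polynomial.C ((β l - β u)⁻¹)))
    (r : ℕ) (hr : 1 ≤ r)
    (hrep : ∀ k : Fin K, r ≤ (Finset.univ.filter (fun i : Fin N => k ∈ Γ i)).card) :
    f.natDegree ≤ (N - r) + (m - 1) ∧
      ∀ a s : ℕ, m = r - 2 * a - s → f.natDegree ≤ N - 2 * a - s - 1 := by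
  have hprod : ∀ {n : ℕ} (S : Finset (Fin n)) (c d : Fin n → F),
      (∏ i ∈ S, ((Polynomial.X - Polynomial.C (c i)) * Polynomial.C (d i))).natDegree
        ≤ S.card := by
    intro n S c d
    refine (Polynomial.natDegree_prod_le _ _).trans ?_
    rw [Finset.card_eq_sum_ones]
    refine Finset.sum_le_sum fun i _ => ?_
    exact (Polynomial.natDegree_mul_C_le _ _).trans (Polynomial.natDegree_X_sub_C_le _)
  have hcard : ∀ k : Fin K,
      (Finset.univ.filter (fun i : Fin N => k ∈ Γ i)).card
        + (Finset.univ.filter (fun i : Fin N => k ∉ Γ i)).card = N := by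
    intro k
    rw [Finset.card_filter_add_card_filter_not]
    simp
  have hrN : r ≤ N := by
    have h1 := hrep ⟨0, hK⟩
    have h2 := hcard ⟨0, hK⟩
    omega
  have hpdeg : ∀ l, (p l).natDegree ≤ N - r := by
    intro l
    rw [hp l]
    refine Polynomial.natDegree_sum_le_of_forall_le _ _ fun k _ => ?_
    refine (Polynomial.natDegree_C_mul_le _ _).trans ((hprod _ _ _).trans ?_)
    have h1 := hrep k
    have h2 := hcard k
    omega
  have main : f.natDegree ≤ (N - r) + (m - 1) := by
    rw [hf]
    refine Polynomial.natDegree_sum_le_of_forall_le _ _ fun l _ => ?_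
    refine Polynomial.natDegree_mul_le.trans (add_le_add (hpdeg l) ((hprod _ _ _).trans ?_))
    rw [Finset.filter_ne', Finset.card_erase_of_mem (Finset.mem_univ _)]
    simp
  refine ⟨main, fun a s h => ?_⟩
  omega
end

section
/- Degree bound for the intra-cluster encoding polynomial: if r2 ≥ 1 is such that every index k that appears in some worker set of cluster n (i.e., k ∈ ∪_j Γ_{(n,j)}) belongs to at least r2 of the sets Γ_{(n,1)},…,Γ_{(n,N2)}, then the intra-cluster polynomial f^{(n)} has degree at most (N2 − r2) + (m2 − 1). In particular, with m2 = r2 − 2a2 − s2 for nonnegative integers a2, s2, the degree of f^{(n)} is at most N2 − 2a2 − s2 − 1. -/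
/- Degree bound for the intra-cluster encoding polynomial: at most
`(N2 - r2) + (m2 - 1)`; in particular, with `m2 = r2 - 2a2 - s2`, at most
`N2 - 2a2 - s2 - 1`. -/
theorem intra_cluster_degree_bound
    {F : Type*} [Field F] (N1 m1 N2 m2 K : ℕ)
    (hN1 : 0 < N1) (hm1 : 0 < m1) (hN2 : 0 < N2) (hm2 : 0 < m2) (hK : 0 < K)
    (α1 : Fin N1 → F) (β1 : Fin m1 → F)
    (hdist1 : Function.Injective (Sum.elim α1 β1 : Fin N1 ⊕ Fin m1 → F))
    (α2 : Fin N2 → F) (β2 : Fin m2 → F)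
    (hdist2 : Function.Injective (Sum.elim α2 β2 : Fin N2 ⊕ Fin m2 → F))
    (Γ : Fin N1 → Finset (Fin K)) (n : Fin N1)
    (Γw : Fin N2 → Finset (Fin K))
    (hΓn : Γ n = (Finset.univ : Finset (Fin N2)).biUnion Γw)
    (g : Fin K → Fin m1 → Fin m2 → F)
    (A : Fin K → Fin m1 → F)
    (hA : ∀ (k : Fin K) (l1 : Fin m1), A k l1 =
      (∏ i ∈ Finset.univ.filter (fun i : Fin N1 => k ∉ Γ i),
        ((α1 n - α1 i) / (β1 l1 - α1 i))) *
      (∏ u1 ∈ Finset.univ.filter (fun u1 : Fin m1 => u1 ≠ l1),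
        ((α1 n - β1 u1) / (β1 l1 - β1 u1))))
    (p : Fin m2 → Polynomial F)
    (hp : ∀ l2 : Fin m2, p l2 = ∑ l1 : Fin m1, ∑ k : Fin K,
      Polynomial.C (g k l1 l2 * A k l1) *
      ∏ j ∈ Finset.univ.filter (fun j : Fin N2 => k ∉ Γw j),
        ((Polynomial.X - Polynomial.C (α2 j)) * Polynomial.C ((β2 l2 - α2 j)⁻¹)))
    (f : Polynomial F)
    (hf : f = ∑ l2 : Fin m2, p l2 *
      ∏ u2 ∈ Finset.univ.filter (fun u2 : Fin m2 => u2 ≠ l2),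
        ((Polynomial.X - Polynomial.C (β2 u2)) * Polynomial.C ((β2 l2 - β2 u2)⁻¹)))
    (r2 : ℕ) (hr2 : 1 ≤ r2)
    (hrep : ∀ k : Fin K, (∃ j : Fin N2, k ∈ Γw j) →
      r2 ≤ (Finset.univ.filter (fun j : Fin N2 => k ∈ Γw j)).card) :
    f.natDegree ≤ (N2 - r2) + (m2 - 1) ∧
      ∀ a2 s2 : ℕ, m2 = r2 - 2 * a2 - s2 → f.natDegree ≤ N2 - 2 * a2 - s2 - 1 := by
  have hA0 : ∀ k l1, (¬ ∃ j : Fin N2, k ∈ Γw j) → A k l1 = 0 := by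
    intro k l1 hk
    rw [hA]
    have hkn : k ∉ Γ n := by
      rw [hΓn]
      simpa using hk
    rw [Finset.prod_eq_zero (i := n) (by simp [hkn]) (by simp), zero_mul]
  have hlin : ∀ a b : F,
      ((Polynomial.X - Polynomial.C a) * Polynomial.C b).natDegree ≤ 1 := by
    intro a b
    refine (Polynomial.natDegree_mul_C_le _ _).trans ?_
    exact Polynomial.natDegree_X_sub_C_le a
  have hprod : ∀ (M : ℕ) (s : Finset (Fin M)) (a b : Fin M → F),
      (∏ j ∈ s, ((Polynomial.X - Polynomial.C (a j)) * Polynomial.C (b j))).natDegree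
        ≤ s.card := by
    intro M s a b
    refine (Polynomial.natDegree_prod_le _ _).trans ?_
    refine (Finset.sum_le_sum (fun j _ => hlin (a j) (b j))).trans ?_
    simp
  have hpdeg : ∀ l2, (p l2).natDegree ≤ N2 - r2 := by
    intro l2
    rw [hp]
    refine Polynomial.natDegree_sum_le_of_forall_le _ _ fun l1 _ => ?_
    refine Polynomial.natDegree_sum_le_of_forall_le _ _ fun k _ => ?_
    by_cases hk : ∃ j : Fin N2, k ∈ Γw j
    · refine (Polynomial.natDegree_C_mul_le _ _).trans ?_
      refine (hprod N2 _ α2 (fun j => (β2 l2 - α2 j)⁻¹)).trans ?_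
      have h1 := hrep k hk
      have h2 := Finset.card_filter_add_card_filter_not (s := (Finset.univ : Finset (Fin N2)))
        (fun j => k ∈ Γw j)
      simp only [Finset.card_univ, Fintype.card_fin] at h2
      omega
    · simp [hA0 k l1 hk]
  have hmain : f.natDegree ≤ (N2 - r2) + (m2 - 1) := by
    rw [hf]
    refine Polynomial.natDegree_sum_le_of_forall_le _ _ fun l2 _ => ?_
    refine Polynomial.natDegree_mul_le.trans (Nat.add_le_add (hpdeg l2) ?_)
    refine (hprod m2 _ β2 (fun u => (β2 l2 - β2 u)⁻¹)).trans ?_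
    rw [Finset.filter_ne', Finset.card_erase_of_mem (Finset.mem_univ _)]
    simp
  refine ⟨hmain, fun a2 s2 hm => ?_⟩
  by_cases hle : r2 ≤ N2
  · omega
  · have hno : ∀ k : Fin K, ¬ ∃ j : Fin N2, k ∈ Γw j := by
      intro k hk
      have h1 := hrep k hk
      have h2 := Finset.card_filter_le (Finset.univ : Finset (Fin N2)) (fun j => k ∈ Γw j)
      simp only [Finset.card_univ, Fintype.card_fin] at h2
      omega
    have hp0 : ∀ l2, p l2 = 0 := by
      intro l2
      rw [hp]
      refine Finset.sum_eq_zero fun l1 _ => Finset.sum_eq_zero fun k _ => ?_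
      simp [hA0 k l1 (hno k)]
    have hf0 : f = 0 := by
      rw [hf]
      exact Finset.sum_eq_zero fun l2 _ => by rw [hp0, zero_mul]
    simp [hf0]
end

section
/- Correct recovery despite masking: for every j ∈ {1,…,m}, the privacy-preserving cluster-to-server polynomial satisfies f^π(β_j) = Σ_{k=1}^{K} g_{k,j}. That is, the randomness term Σ_{l=1}^{m} q_l(x) · Π_{u=1}^{m} (x − β_u) vanishes at each recovery point β_j (because the product contains the factor β_j − β_j = 0), so the server recovers exactly the sum of the gradient parts regardless of the random scalars z_{k',l}. -/
/- Correct recovery despite masking: the privacy-preserving cluster-to-server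
polynomial `fπ` satisfies `fπ (β j) = ∑ k, g k j`; the randomness term vanishes
at each recovery point `β j`. -/
theorem private_cluster_to_server_recovery
    {F : Type*} [Field F] (N m K K' : ℕ)
    (hN : 0 < N) (hm : 0 < m) (hK : 0 < K) (hK' : 0 < K')
    (α : Fin N → F) (β : Fin m → F)
    (hdist : Function.Injective (Sum.elim α β : Fin N ⊕ Fin m → F))
    (Γ : Fin N → Finset (Fin K)) (Γ' : Fin N → Finset (Fin K'))
    (g : Fin K → Fin m → F) (z : Fin K' → Fin m → F)
    (p : Fin m → Polynomial F)
    (hp : ∀ l : Fin m, p l = ∑ k : Fin K, Polynomial.C (g k l) *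
      ∏ i ∈ Finset.univ.filter (fun i : Fin N => k ∉ Γ i),
        ((Polynomial.X - Polynomial.C (α i)) * Polynomial.C ((β l - α i)⁻¹)))
    (q : Fin m → Polynomial F)
    (hq : ∀ l : Fin m, q l = ∑ k' : Fin K', Polynomial.C (z k' l) *
      ∏ i ∈ Finset.univ.filter (fun i : Fin N => k' ∉ Γ' i),
        ((Polynomial.X - Polynomial.C (α i)) * Polynomial.C ((β l - α i)⁻¹)))
    (fπ : Polynomial F)
    (hfπ : fπ = (∑ l : Fin m, p l *
      ∏ u ∈ Finset.univ.filter (fun u : Fin m => u ≠ l),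
        ((Polynomial.X - Polynomial.C (β u)) * Polynomial.C ((β l - β u)⁻¹)))
      + ∑ l : Fin m, q l * ∏ u : Fin m, (Polynomial.X - Polynomial.C (β u))) :
    ∀ j : Fin m, fπ.eval (β j) = ∑ k : Fin K, g k j := by
  intro j
  have hαβ : ∀ i, β j - α i ≠ 0 := fun i h => by
    have h2 := @hdist (Sum.inr j) (Sum.inl i) (by simpa using sub_eq_zero.mp h)
    cases h2
  have hββ : ∀ u, u ≠ j → β j - β u ≠ 0 := fun u hu h => by
    have h2 := @hdist (Sum.inr j) (Sum.inr u) (by simpa using sub_eq_zero.mp h)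
    exact hu (Sum.inr.inj h2).symm
  have hz : ∏ u : Fin m, (β j - β u) = 0 :=
    Finset.prod_eq_zero (Finset.mem_univ j) (sub_self _)
  have hpj : (p j).eval (β j) = ∑ k : Fin K, g k j := by
    rw [hp, Polynomial.eval_finset_sum]
    refine Finset.sum_congr rfl fun k _ => ?_
    rw [Polynomial.eval_mul, Polynomial.eval_C, Polynomial.eval_prod,
      Finset.prod_eq_one, mul_one]
    intro i _
    simp [mul_inv_cancel₀ (hαβ i)]
  rw [hfπ, Polynomial.eval_add, Polynomial.eval_finset_sum, Polynomial.eval_finset_sum,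
    Finset.sum_eq_single j, Finset.sum_eq_zero, add_zero, Polynomial.eval_mul, hpj,
    Polynomial.eval_prod, Finset.prod_eq_one, mul_one]
  · intro u hu
    simp [mul_inv_cancel₀ (hββ u (Finset.mem_filter.mp hu).2)]
  · intro l _
    rw [Polynomial.eval_mul, Polynomial.eval_prod]
    simp [hz]
  · intro l _ hl
    rw [Polynomial.eval_mul, Polynomial.eval_prod,
      Finset.prod_eq_zero (i := j) (by simp [hl.symm]) (by simp), mul_zero]
  · intro h
    exact absurd (Finset.mem_univ j) h
end

section
/- Degree bound for the privacy-preserving cluster-to-server polynomial: if r ≥ 1 is such that every k ∈ {1,…,K} belongs to at least r of the sets Γ_1,…,Γ_N, and every k' ∈ {1,…,K'} belongs to at least r + 1 of the sets Γ'_1,…,Γ'_N, then f^π has degree at most (N − r) + (m − 1): indeed each p_l has degree at most N − r and is multiplied by a polynomial of degree m − 1, while each q_l has degree at most N − r − 1 and is multiplied by a polynomial of degree m. In particular, with m = r − 2a − s for nonnegative integers a, s, the degree of f^π is at most N − 2a − s − 1. -/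
theorem natDegree_prod_aux {F ι : Type*} [Field F] (s : Finset ι) (a c : ι → F) :
    (∏ i ∈ s, ((Polynomial.X - Polynomial.C (a i)) * Polynomial.C (c i))).natDegree ≤ s.card := by
  refine (Polynomial.natDegree_prod_le _ _).trans ?_
  rw [Finset.card_eq_sum_ones]
  refine Finset.sum_le_sum fun i _ => ?_
  refine (Polynomial.natDegree_mul_C_le _ _).trans ?_
  rw [Polynomial.natDegree_X_sub_C]

theorem card_compl_aux {N K : ℕ} (Γ : Fin N → Finset (Fin K)) (k : Fin K) (r : ℕ)
    (h : r ≤ (Finset.univ.filter (fun i : Fin N => k ∈ Γ i)).card) :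
    (Finset.univ.filter (fun i : Fin N => k ∉ Γ i)).card + r ≤ N := by
  have := Finset.card_filter_add_card_filter_not (s := (Finset.univ : Finset (Fin N)))
    (fun i : Fin N => k ∈ Γ i)
  rw [Finset.card_univ, Fintype.card_fin] at this
  omega

/- Degree bound for the privacy-preserving cluster-to-server polynomial:
at most `(N - r) + (m - 1)`; in particular, with `m = r - 2a - s`, at most
`N - 2a - s - 1`. -/
theorem private_cluster_to_server_degree_bound
    {F : Type*} [Field F] (N m K K' : ℕ)
    (hN : 0 < N) (hm : 0 < m) (hK : 0 < K) (hK' : 0 < K')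
    (α : Fin N → F) (β : Fin m → F)
    (hdist : Function.Injective (Sum.elim α β : Fin N ⊕ Fin m → F))
    (Γ : Fin N → Finset (Fin K)) (Γ' : Fin N → Finset (Fin K'))
    (g : Fin K → Fin m → F) (z : Fin K' → Fin m → F)
    (p : Fin m → Polynomial F)
    (hp : ∀ l : Fin m, p l = ∑ k : Fin K, Polynomial.C (g k l) *
      ∏ i ∈ Finset.univ.filter (fun i : Fin N => k ∉ Γ i),
        ((Polynomial.X - Polynomial.C (α i)) * Polynomial.C ((β l - α i)⁻¹)))
    (q : Fin m → Polynomial F)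
    (hq : ∀ l : Fin m, q l = ∑ k' : Fin K', Polynomial.C (z k' l) *
      ∏ i ∈ Finset.univ.filter (fun i : Fin N => k' ∉ Γ' i),
        ((Polynomial.X - Polynomial.C (α i)) * Polynomial.C ((β l - α i)⁻¹)))
    (fπ : Polynomial F)
    (hfπ : fπ = (∑ l : Fin m, p l *
      ∏ u ∈ Finset.univ.filter (fun u : Fin m => u ≠ l),
        ((Polynomial.X - Polynomial.C (β u)) * Polynomial.C ((β l - β u)⁻¹)))
      + ∑ l : Fin m, q l * ∏ u : Fin m, (Polynomial.X - Polynomial.C (β u)))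
    (r : ℕ) (hr : 1 ≤ r)
    (hrep : ∀ k : Fin K, r ≤ (Finset.univ.filter (fun i : Fin N => k ∈ Γ i)).card)
    (hrep' : ∀ k' : Fin K', r + 1 ≤ (Finset.univ.filter (fun i : Fin N => k' ∈ Γ' i)).card) :
    fπ.natDegree ≤ (N - r) + (m - 1) ∧
      ∀ a s : ℕ, m = r - 2 * a - s → fπ.natDegree ≤ N - 2 * a - s - 1 := by
  have hrN : r + 1 ≤ N := by
    have := card_compl_aux Γ' ⟨0, hK'⟩ (r + 1) (hrep' _)
    omega
  have hpd : ∀ l, (p l).natDegree ≤ N - r := by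
    intro l
    rw [hp l]
    refine Polynomial.natDegree_sum_le_of_forall_le _ _ fun k _ => ?_
    refine (Polynomial.natDegree_C_mul_le _ _).trans ((natDegree_prod_aux _ _ _).trans ?_)
    have := card_compl_aux Γ k r (hrep k)
    omega
  have hqd : ∀ l, (q l).natDegree ≤ N - r - 1 := by
    intro l
    rw [hq l]
    refine Polynomial.natDegree_sum_le_of_forall_le _ _ fun k _ => ?_
    refine (Polynomial.natDegree_C_mul_le _ _).trans ((natDegree_prod_aux _ _ _).trans ?_)
    have := card_compl_aux Γ' k (r + 1) (hrep' k)
    omega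
  have main : fπ.natDegree ≤ (N - r) + (m - 1) := by
    rw [hfπ]
    refine Polynomial.natDegree_add_le_of_degree_le ?_ ?_
    · refine Polynomial.natDegree_sum_le_of_forall_le _ _ fun l _ => ?_
      refine Polynomial.natDegree_mul_le.trans (Nat.add_le_add (hpd l) ?_)
      refine (natDegree_prod_aux _ _ _).trans ?_
      rw [Finset.filter_ne', Finset.card_erase_of_mem (Finset.mem_univ _), Finset.card_univ,
        Fintype.card_fin]
    · refine Polynomial.natDegree_sum_le_of_forall_le _ _ fun l _ => ?_
      have h2 : (∏ u : Fin m, (Polynomial.X - Polynomial.C (β u))).natDegree ≤ m := by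
        have := natDegree_prod_aux (Finset.univ : Finset (Fin m)) β (fun _ => 1)
        simpa only [Polynomial.C_1, mul_one, Finset.card_univ, Fintype.card_fin] using this
      have h1 := hqd l
      refine Polynomial.natDegree_mul_le.trans ?_
      omega
  refine ⟨main, fun a s h => ?_⟩
  omega
end
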